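/- Let τ ∈ ℂ with Im τ > 0, let B ∈ GL_n(ℂ) and let v ∈ ℂ with v ∉ Σ_B. Let Sol be the complex vector space of holomorphic functions Φ : ℂ → Mat_{n×n}(ℂ) satisfying Φ(z+1) = Φ(z) and Φ(z+τ)·B = −exp(−2πi(z+v+τ))·B·Φ(z) for all z ∈ ℂ. Then the evaluation map res₀ : Sol → Mat_{n×n}(ℂ), Φ ↦ Φ(0), is a ℂ-linear isomorphism. -/

import Mathlib

open Complex Matrix
open scoped TensorProduct

noncomputable section

/-- π as a complex number. -/
def πc : ℂ := Real.pi

/-- The lattice Λ = ℤ + τℤ ⊂ ℂ. -/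
def latticeL (τ : ℂ) : Set ℂ := {x | ∃ m k : ℤ, x = (m : ℂ) + (k : ℂ) * τ}

/-- Σ_B = {λ − λ' : exp(2πiλ), exp(2πiλ') eigenvalues of B} + Λ. -/
def SigmaSet (n : ℕ) (τ : ℂ) (B : Matrix (Fin n) (Fin n) ℂ) : Set ℂ :=
  {x | ∃ l l' : ℂ, Complex.exp (2 * πc * I * l) ∈ spectrum ℂ B ∧
    Complex.exp (2 * πc * I * l') ∈ spectrum ℂ B ∧
    ∃ w ∈ latticeL τ, x = l - l' + w}

/-- The space of holomorphic matrix-valued functions with Φ(z+1) = Φ(z) and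
Φ(z+τ)·B = c(z)·B·Φ(z). -/
def SolSpace (n : ℕ) (τ : ℂ) (B : Matrix (Fin n) (Fin n) ℂ) (c : ℂ → ℂ) :
    Submodule ℂ (ℂ → Matrix (Fin n) (Fin n) ℂ) where
  carrier := {Φ | (∀ i j, Differentiable ℂ fun z => Φ z i j) ∧
    (∀ z, Φ (z + 1) = Φ z) ∧ (∀ z, Φ (z + τ) * B = c z • (B * Φ z))}
  add_mem' := by
    rintro Φ Ψ ⟨hd, hp, hq⟩ ⟨gd, gp, gq⟩
    refine ⟨fun i j => ?_, fun z => ?_, fun z => ?_⟩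
    · show Differentiable ℂ fun z => Φ z i j + Ψ z i j
      exact (hd i j).add (gd i j)
    · show Φ (z + 1) + Ψ (z + 1) = Φ z + Ψ z
      rw [hp, gp]
    · show (Φ (z + τ) + Ψ (z + τ)) * B = c z • (B * (Φ z + Ψ z))
      rw [add_mul, hq, gq, Matrix.mul_add, smul_add]
  zero_mem' := by
    refine ⟨fun i j => ?_, fun z => rfl, fun z => by simp⟩
    show Differentiable ℂ fun _ => (0 : ℂ)
    exact differentiable_const 0
  smul_mem' := by
    rintro a Φ ⟨hd, hp, hq⟩
    refine ⟨fun i j => ?_, fun z => ?_, fun z => ?_⟩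
    · show Differentiable ℂ fun z => a • Φ z i j
      exact (hd i j).const_smul a
    · show a • Φ (z + 1) = a • Φ z
      rw [hp]
    · show (a • Φ (z + τ)) * B = c z • (B * (a • Φ z))
      rw [Matrix.smul_mul, hq, Matrix.mul_smul, smul_comm]

/-- The residue map res₀ : Sol → Mat_{n×n}(ℂ), Φ ↦ Φ(0) (more generally, evaluation at y),
as a ℂ-linear map. -/
def resEv (n : ℕ) (τ : ℂ) (B : Matrix (Fin n) (Fin n) ℂ) (c : ℂ → ℂ) (y : ℂ) :
    SolSpace n τ B c →ₗ[ℂ] Matrix (Fin n) (Fin n) ℂ where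
  toFun Φ := Φ.1 y
  map_add' _ _ := rfl
  map_smul' _ _ := rfl

/-- The `k`-th Fourier coefficient of a function with period `1`, taken along `[0, 1]`. -/
def fourierCoeffUnit (k : ℤ) (f : ℂ → ℂ) : ℂ :=
  ∫ t in (0 : ℝ)..1, f t * Complex.exp (-(2 * Real.pi * I * k * t))

/-- The mean over a period of a periodic entire function does not depend on the contour. -/
lemma integral_add_of_periodic {G : ℂ → ℂ} (hG : Differentiable ℂ G)
    (hp : ∀ z, G (z + 1) = G z) (w : ℂ) :
    ∫ t in (0 : ℝ)..1, G (t + w) = ∫ t in (0 : ℝ)..1, G t := by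
  have h := Complex.integral_boundary_rect_eq_zero_of_differentiableOn G 0 (1 + w.im * I)
    hG.differentiableOn
  have hv : ∀ y : ℝ, G (1 + y * I) = G (y * I) := fun y => by rw [add_comm, hp]
  simp [hv] at h
  rw [sub_eq_zero] at h
  have hper : Function.Periodic (fun t : ℝ => G (t + w.im * I)) 1 := fun t => by
    show G (((t + 1 : ℝ) : ℂ) + w.im * I) = G (t + w.im * I)
    rw [← hp (t + w.im * I)]
    congr 1
    push_cast
    ring
  have h2 := hper.intervalIntegral_add_eq w.re 0
  rw [zero_add] at h2
  rw [h, ← h2]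
  have h3 := intervalIntegral.integral_comp_add_right (a := 0) (b := 1)
    (fun t : ℝ => G (t + w.im * I)) w.re
  rw [zero_add, add_comm 1] at h3
  rw [← h3]
  congr 1
  ext t
  congr 1
  conv_lhs => rw [← Complex.re_add_im w]
  push_cast
  ring

lemma exp_int_periodic (k : ℤ) (z : ℂ) :
    Complex.exp (-(2 * Real.pi * I * k * (z + 1))) = Complex.exp (-(2 * Real.pi * I * k * z)) := by
  rw [Complex.exp_eq_exp_iff_exists_int]
  exact ⟨-k, by push_cast; ring⟩

/-- Translation by `w` multiplies the `k`-th Fourier coefficient by `exp (2πikw)`. -/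
lemma fourierCoeffUnit_translate {f : ℂ → ℂ} (hf : Differentiable ℂ f)
    (hp : ∀ z, f (z + 1) = f z) (k : ℤ) (w : ℂ) :
    fourierCoeffUnit k (fun z => f (z + w))
      = Complex.exp (2 * Real.pi * I * k * w) * fourierCoeffUnit k f := by
  have h := integral_add_of_periodic
    (G := fun z => f z * Complex.exp (-(2 * Real.pi * I * k * z))) (by fun_prop)
    (fun z => by rw [hp, exp_int_periodic]) w
  unfold fourierCoeffUnit
  rw [← h, ← intervalIntegral.integral_const_mul]
  congr 1
  ext t
  rw [mul_left_comm, ← Complex.exp_add]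
  congr 2
  ring

/-- Multiplication by `exp (-2πiz)` shifts the Fourier coefficients. -/
lemma fourierCoeffUnit_exp_mul (f : ℂ → ℂ) (k : ℤ) :
    fourierCoeffUnit k (fun z => Complex.exp (-(2 * Real.pi * I * z)) * f z)
      = fourierCoeffUnit (k + 1) f := by
  unfold fourierCoeffUnit
  congr 1
  ext t
  dsimp only
  rw [mul_comm (Complex.exp _), mul_assoc, ← Complex.exp_add]
  congr 2
  push_cast
  ring

lemma fourierCoeffUnit_const_mul (f : ℂ → ℂ) (k : ℤ) (a : ℂ) :
    fourierCoeffUnit k (fun z => a * f z) = a * fourierCoeffUnit k f := by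
  unfold fourierCoeffUnit
  rw [← intervalIntegral.integral_const_mul]
  simp_rw [mul_assoc]

lemma fourierCoeffUnit_sum {ι : Type*} (s : Finset ι) (f : ι → ℂ → ℂ)
    (hf : ∀ i, Continuous (f i)) (k : ℤ) :
    fourierCoeffUnit k (fun z => ∑ i ∈ s, f i z) = ∑ i ∈ s, fourierCoeffUnit k (f i) := by
  unfold fourierCoeffUnit
  rw [← intervalIntegral.integral_finsetSum]
  · simp_rw [Finset.sum_mul]
  · intro i _
    have := hf i
    exact Continuous.intervalIntegrable (by fun_prop) _ _

lemma fourierCoeffUnit_add {f g : ℂ → ℂ} (hf : Continuous f) (hg : Continuous g) (k : ℤ) :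
    fourierCoeffUnit k (fun z => f z + g z) = fourierCoeffUnit k f + fourierCoeffUnit k g := by
  unfold fourierCoeffUnit
  rw [← intervalIntegral.integral_add]
  · simp_rw [add_mul]
  · exact Continuous.intervalIntegrable (by fun_prop) _ _
  · exact Continuous.intervalIntegrable (by fun_prop) _ _

/-- An entire function of period `1` all of whose Fourier coefficients vanish is zero. -/
lemma eq_zero_of_fourierCoeffUnit_eq_zero {f : ℂ → ℂ} (hf : Differentiable ℂ f)
    (hp : ∀ z, f (z + 1) = f z) (h0 : ∀ k, fourierCoeffUnit k f = 0) : f = 0 := by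
  have : Fact ((0 : ℝ) < 1) := ⟨one_pos⟩
  have hc := hf.continuous
  let F : C(AddCircle (1 : ℝ), ℂ) := ⟨AddCircle.liftIco 1 0 (fun t : ℝ => f t),
    AddCircle.liftIco_zero_continuous (by simpa using (hp 0).symm)
      (Continuous.continuousOn (by fun_prop))⟩
  have hF : ∀ k, fourierCoeff F k = 0 := fun k => by
    have e := fourierCoeff_liftIco_eq (T := 1) (a := 0) (fun t : ℝ => f t) k
    rw [fourierCoeffOn_eq_integral] at e
    refine e.trans ?_
    have := h0 k
    unfold fourierCoeffUnit at this
    simp only [fourier_coe_apply, smul_eq_mul]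
    refine smul_eq_zero_of_right _ (Eq.trans ?_ this)
    rw [zero_add]
    congr 1
    ext t
    rw [mul_comm]
    congr 2
    push_cast
    ring
  have hs : HasSum (fun i => fourierCoeff F i • fourier (T := 1) i) F :=
    hasSum_fourier_series_of_summable (by simp [funext hF, summable_zero])
  have hF0 : F = 0 := by
    simp only [hF, zero_smul] at hs
    exact hs.unique hasSum_zero
  have hz : ∀ t ∈ Set.Ico (0 : ℝ) 1, f t = 0 := fun t ht => by
    rw [← AddCircle.liftIco_zero_coe_apply (p := (1 : ℝ)) (f := fun t : ℝ => f t) ht]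
    exact congrArg (fun G : C(AddCircle (1 : ℝ), ℂ) => G t) hF0
  refine AnalyticOnNhd.eq_of_frequently_eq (z₀ := 0)
    (fun z _ => hf.analyticAt z) (fun z _ => analyticAt_const) ?_
  have ht : Filter.Tendsto (fun n : ℕ => (((1 : ℝ) / ((n : ℝ) + 2) : ℝ) : ℂ)) Filter.atTop
      (nhdsWithin 0 {0}ᶜ) := by
    refine tendsto_nhdsWithin_iff.2 ⟨?_, .of_forall fun n => ?_⟩
    · have := (tendsto_one_div_add_atTop_nhds_zero_nat (𝕜 := ℝ)).comp (Filter.tendsto_add_atTop_nat 1)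
      have h2 := (Complex.continuous_ofReal.tendsto 0).comp this
      rw [Complex.ofReal_zero] at h2
      refine h2.congr fun n => ?_
      simp only [Function.comp]
      push_cast
      ring
    · have : ((1 : ℝ) / ((n : ℝ) + 2)) ≠ 0 := by positivity
      exact Complex.ofReal_ne_zero.2 this
  refine ht.frequently (Filter.Frequently.of_forall fun n => ?_)
  refine hz _ ⟨by positivity, ?_⟩
  rw [div_lt_one (by positivity)]
  linarith [(Nat.cast_nonneg n : (0 : ℝ) ≤ n)]

/-- A matrix of periodic entire functions satisfying `Φ(z+τ)B = C exp(-2πiz) BΦ(z)` is determined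
by its mean over a period. -/
lemma eq_zero_of_fourierCoeffUnit_zero_eq_zero {ι : Type*} [Fintype ι] [DecidableEq ι] {τ C : ℂ}
    (hC : C ≠ 0) {B : Matrix ι ι ℂ} (hB : IsUnit B) {Φ : ℂ → Matrix ι ι ℂ}
    (hd : ∀ i j, Differentiable ℂ fun z => Φ z i j) (hp : ∀ z, Φ (z + 1) = Φ z)
    (hq : ∀ z, Φ (z + τ) * B = (C * Complex.exp (-(2 * Real.pi * I * z))) • (B * Φ z))
    (h0 : ∀ i j, fourierCoeffUnit 0 (fun z => Φ z i j) = 0) : ∀ z, Φ z = 0 := by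
  let a : ℤ → Matrix ι ι ℂ := fun k => .of fun i j => fourierCoeffUnit k fun z => Φ z i j
  have hrec : ∀ k : ℤ, Complex.exp (2 * Real.pi * I * k * τ) • (a k * B) = C • (B * a (k + 1)) := by
    intro k
    ext i j
    have hl : fourierCoeffUnit k (fun z => (Φ (z + τ) * B) i j)
        = Complex.exp (2 * Real.pi * I * k * τ) * (a k * B) i j := by
      simp only [Matrix.mul_apply, mul_comm _ (B _ j)]
      rw [fourierCoeffUnit_sum _ _ fun l => by
        have := (hd i l).continuous
        fun_prop, Finset.mul_sum]
      refine Finset.sum_congr rfl fun l _ => ?_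
      rw [fourierCoeffUnit_const_mul, fourierCoeffUnit_translate (hd i l) fun z => by rw [hp]]
      simp only [a, Matrix.of_apply]
      ring
    have hr : fourierCoeffUnit k (fun z => (Φ (z + τ) * B) i j) = C * (B * a (k + 1)) i j := by
      have e : ∀ z, (Φ (z + τ) * B) i j
          = C * (Complex.exp (-(2 * Real.pi * I * z)) * (B * Φ z) i j) := fun z => by
        rw [hq, Matrix.smul_apply, smul_eq_mul, mul_assoc]
      simp only [e]
      rw [fourierCoeffUnit_const_mul, fourierCoeffUnit_exp_mul]
      simp only [Matrix.mul_apply]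
      rw [fourierCoeffUnit_sum _ _ fun l => by
        have := (hd l j).continuous
        fun_prop]
      simp only [fourierCoeffUnit_const_mul, a, Matrix.of_apply]
    simpa using hl.symm.trans hr
  have hup : ∀ k, a k = 0 → a (k + 1) = 0 := fun k hk => by
    have h := hrec k
    rw [hk, zero_mul, smul_zero, eq_comm, smul_eq_zero_iff_right hC] at h
    exact hB.mul_right_eq_zero.1 h
  have hdown : ∀ k, a (k + 1) = 0 → a k = 0 := fun k hk => by
    have h := hrec k
    rw [hk, mul_zero, smul_zero, smul_eq_zero_iff_right (Complex.exp_ne_zero _)] at h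
    exact hB.mul_left_eq_zero.1 h
  have hall : ∀ k, a k = 0 := fun k => by
    induction k using Int.induction_on with
    | zero => ext i j; exact h0 i j
    | succ k ih => exact hup _ ih
    | pred k ih => exact hdown _ (by simpa using ih)
  intro z
  ext i j
  exact congrFun (eq_zero_of_fourierCoeffUnit_eq_zero (hd i j) (fun z => by rw [hp])
    fun k => congrFun (congrFun (hall k) i) j) z

/-- The `q`-Pochhammer symbol `(y; q)_∞ = ∏ (1 - qⁿ y)`. -/
def qPochhammerInf (q y : ℂ) : ℂ := ∏' n : ℕ, (1 + -(q ^ n * y))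

lemma summable_norm_qPochhammerInf {q : ℂ} (hq : ‖q‖ < 1) (y : ℂ) :
    Summable fun n : ℕ => ‖-(q ^ n * y)‖ := by
  simpa using (summable_geometric_of_lt_one (norm_nonneg _) hq).mul_right ‖y‖

lemma qPochhammerInf_eq {q : ℂ} (hq : ‖q‖ < 1) (y : ℂ) :
    qPochhammerInf q y = (1 - y) * qPochhammerInf q (q * y) := by
  unfold qPochhammerInf
  rw [tprod_eq_zero_mul']
  · simp only [pow_zero, one_mul, pow_succ, mul_assoc, sub_eq_add_neg]
  · refine multipliable_one_add_of_summable ?_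
    exact (summable_nat_add_iff 1).2 (summable_norm_qPochhammerInf hq y)

lemma exists_of_qPochhammerInf_eq_zero {q : ℂ} (hq : ‖q‖ < 1) {y : ℂ}
    (h : qPochhammerInf q y = 0) : ∃ n : ℕ, q ^ n * y = 1 := by
  by_contra! hne
  refine tprod_one_add_ne_zero_of_summable (fun n => ?_) (summable_norm_qPochhammerInf hq y) h
  rw [← sub_eq_add_neg, sub_ne_zero]
  exact (hne n).symm

lemma differentiable_qPochhammerInf {q : ℂ} (hq : ‖q‖ < 1) :
    Differentiable ℂ (qPochhammerInf q) := by
  intro y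
  have hlu : HasProdLocallyUniformlyOn (fun (n : ℕ) (x : ℂ) => 1 + -(q ^ n * x))
      (qPochhammerInf q) (Metric.ball 0 (‖y‖ + 1)) := by
    refine Summable.hasProdLocallyUniformlyOn_nat_one_add Metric.isOpen_ball
      ((summable_geometric_of_lt_one (norm_nonneg _) hq).mul_right (‖y‖ + 1))
      (.of_forall fun n x hx => ?_) (fun n => by fun_prop)
    rw [norm_neg, norm_mul, norm_pow]
    gcongr
    exact (mem_ball_zero_iff.1 hx).le
  refine (hlu.differentiableOn (.of_forall fun s => ?_) Metric.isOpen_ball).differentiableAt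
    (Metric.isOpen_ball.mem_nhds (by simp))
  simpa [Finset.prod_fn] using DifferentiableOn.finsetProd (fun _ _ => by fun_prop)

lemma norm_exp_two_pi_I_lt_one {τ : ℂ} (hτ : 0 < τ.im) :
    ‖Complex.exp (2 * Real.pi * I * τ)‖ < 1 := by
  rw [Complex.norm_exp, Real.exp_lt_one_iff]
  simp
  positivity

/-- The product side of the Jacobi triple product, without its constant factor. -/
def thetaProd (z τ : ℂ) : ℂ :=
  qPochhammerInf (Complex.exp (2 * Real.pi * I * τ)) (Complex.exp (Real.pi * I * (1 + τ + 2 * z))) *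
  qPochhammerInf (Complex.exp (2 * Real.pi * I * τ)) (Complex.exp (Real.pi * I * (1 + τ - 2 * z)))

lemma differentiable_thetaProd {τ : ℂ} (hτ : 0 < τ.im) :
    Differentiable ℂ fun z => thetaProd z τ := by
  have h := differentiable_qPochhammerInf (norm_exp_two_pi_I_lt_one hτ)
  unfold thetaProd
  fun_prop

lemma thetaProd_add_one (z τ : ℂ) : thetaProd (z + 1) τ = thetaProd z τ := by
  unfold thetaProd
  congr 2
  · rw [Complex.exp_eq_exp_iff_exists_int]
    exact ⟨1, by push_cast; ring⟩
  · rw [Complex.exp_eq_exp_iff_exists_int]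
    exact ⟨-1, by push_cast; ring⟩

lemma thetaProd_add_tau {τ : ℂ} (hτ : 0 < τ.im) (z : ℂ) :
    thetaProd (z + τ) τ = Complex.exp (-Real.pi * I * (τ + 2 * z)) * thetaProd z τ := by
  have hq := norm_exp_two_pi_I_lt_one hτ
  unfold thetaProd
  rw [qPochhammerInf_eq hq (Complex.exp (Real.pi * I * (1 + τ - 2 * (z + τ)))),
    qPochhammerInf_eq hq (Complex.exp (Real.pi * I * (1 + τ + 2 * z)))]
  simp only [← Complex.exp_add]
  rw [show 2 * (Real.pi : ℂ) * I * τ + Real.pi * I * (1 + τ - 2 * (z + τ))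
      = Real.pi * I * (1 + τ - 2 * z) by ring,
    show 2 * (Real.pi : ℂ) * I * τ + Real.pi * I * (1 + τ + 2 * z)
      = Real.pi * I * (1 + τ + 2 * (z + τ)) by ring]
  have e : 1 - Complex.exp (Real.pi * I * (1 + τ - 2 * (z + τ)))
      = Complex.exp (-Real.pi * I * (τ + 2 * z)) *
        (1 - Complex.exp (Real.pi * I * (1 + τ + 2 * z))) := by
    rw [mul_sub (Complex.exp _), mul_one, ← Complex.exp_add,
      show -(Real.pi : ℂ) * I * (τ + 2 * z) + Real.pi * I * (1 + τ + 2 * z) = Real.pi * I by ring,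
      Complex.exp_pi_mul_I,
      show (Real.pi : ℂ) * I * (1 + τ - 2 * (z + τ))
        = -Real.pi * I * (τ + 2 * z) + Real.pi * I by ring,
      Complex.exp_add, Complex.exp_pi_mul_I]
    ring
  rw [e]
  ring

lemma exists_of_thetaProd_eq_zero {τ : ℂ} (hτ : 0 < τ.im) {z : ℂ} (h : thetaProd z τ = 0) :
    ∃ m k : ℤ, z = 1 / 2 + τ / 2 + m + k * τ := by
  have hq := norm_exp_two_pi_I_lt_one hτ
  have hpi : (2 * Real.pi * I : ℂ) ≠ 0 := Complex.two_pi_I_ne_zero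
  rcases mul_eq_zero.1 h with h | h <;>
    obtain ⟨n, hn⟩ := exists_of_qPochhammerInf_eq_zero hq h <;>
    rw [← Complex.exp_nat_mul, ← Complex.exp_add, Complex.exp_eq_one_iff] at hn <;>
    obtain ⟨m, hm⟩ := hn
  · refine ⟨m - 1, -n - 1, mul_left_cancel₀ hpi ?_⟩
    push_cast
    linear_combination hm
  · refine ⟨-m, n, mul_left_cancel₀ hpi ?_⟩
    push_cast
    linear_combination -hm

lemma thetaProd_zero_ne_zero {τ : ℂ} (hτ : 0 < τ.im) : thetaProd 0 τ ≠ 0 := by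
  intro h
  obtain ⟨m, k, hk⟩ := exists_of_thetaProd_eq_zero hτ h
  have h2 := congrArg Complex.im hk
  simp at h2
  have h3 : (1 + 2 * (k : ℝ)) * τ.im = 0 := by linarith
  rcases mul_eq_zero.1 h3 with h4 | h4
  · have : 1 + 2 * k = 0 := by exact_mod_cast h4
    omega
  · exact hτ.ne' h4
lemma fourierCoeffUnit_zero_jacobiTheta₂ {τ : ℂ} (hτ : 0 < τ.im) :
    fourierCoeffUnit 0 (fun z => jacobiTheta₂ z τ) = 1 := by
  let F : ℤ → C(ℝ, ℂ) := fun n => ⟨fun t => jacobiTheta₂_term n t τ, by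
    unfold jacobiTheta₂_term
    fun_prop⟩
  have hs := intervalIntegral.hasSum_intervalIntegral_of_summable_norm (a := 0) (b := 1) (f := F) <| by
    refine (summable_pow_mul_jacobiTheta₂_term_bound 0 hτ 0).of_nonneg_of_le
      (fun _ => norm_nonneg _) fun n => ?_
    rw [pow_zero, one_mul]
    refine (ContinuousMap.norm_le _ (Real.exp_pos _).le).2 fun t => ?_
    exact norm_jacobiTheta₂_term_le hτ (by simp) le_rfl n
  have hint : ∀ n : ℤ, ∫ t in (0 : ℝ)..1, F n t = if n = 0 then 1 else 0 := fun n => by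
    split_ifs with hn
    · simp [F, hn, jacobiTheta₂_term]
    · have hc : (2 * Real.pi * I * n : ℂ) ≠ 0 :=
        mul_ne_zero Complex.two_pi_I_ne_zero (Int.cast_ne_zero.2 hn)
      have e : ∀ t : ℝ, F n t = Complex.exp (2 * Real.pi * I * n * t) *
          Complex.exp (Real.pi * I * n ^ 2 * τ) := fun t => by
        rw [← Complex.exp_add]
        rfl
      simp_rw [e]
      rw [intervalIntegral.integral_mul_const, integral_exp_mul_complex hc,
        Complex.ofReal_one, Complex.ofReal_zero, mul_zero, mul_one, Complex.exp_zero,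
        Complex.exp_eq_one_iff.2 ⟨n, by ring⟩]
      simp
  simp_rw [hint] at hs
  have h1 := hs.unique (hasSum_ite_eq (0 : ℤ) (1 : ℂ))
  rw [← h1]
  unfold fourierCoeffUnit
  simp only [Int.cast_zero, mul_zero, zero_mul, neg_zero, Complex.exp_zero, mul_one]
  rfl

/-- The zeros of the Jacobi theta function lie in `1/2 + τ/2 + ℤ + ℤτ`. -/
lemma exists_of_jacobiTheta₂_eq_zero {τ : ℂ} (hτ : 0 < τ.im) {z : ℂ} (h : jacobiTheta₂ z τ = 0) :
    ∃ m k : ℤ, z = 1 / 2 + τ / 2 + m + k * τ := by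
  apply exists_of_thetaProd_eq_zero hτ
  have hdθ : Differentiable ℂ fun z => jacobiTheta₂ z τ :=
    fun z => differentiableAt_jacobiTheta₂_fst z hτ
  have hdP := differentiable_thetaProd hτ
  have hprop : ∀ a b : ℂ, fourierCoeffUnit 0 (fun z => a * thetaProd z τ + b * jacobiTheta₂ z τ) = 0
      → ∀ z, a * thetaProd z τ + b * jacobiTheta₂ z τ = 0 := fun a b h0 z => by
    have := eq_zero_of_fourierCoeffUnit_zero_eq_zero (ι := Unit) (τ := τ)
      (C := Complex.exp (-Real.pi * I * τ)) (Complex.exp_ne_zero _) (B := 1) isUnit_one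
      (Φ := fun z => .of fun _ _ => a * thetaProd z τ + b * jacobiTheta₂ z τ)
      (fun i j => by
        simp only [Matrix.of_apply]
        fun_prop)
      (fun z => by simp only [thetaProd_add_one, jacobiTheta₂_add_left])
      (fun z => by
        ext i j
        simp only [thetaProd_add_tau hτ, jacobiTheta₂_add_left', mul_one, one_mul,
          Matrix.smul_apply, Matrix.of_apply, smul_eq_mul, ← Complex.exp_add]
        rw [show -(Real.pi : ℂ) * I * τ + -(2 * Real.pi * I * z)
          = -Real.pi * I * (τ + 2 * z) by ring]
        ring)
      (fun i j => by simpa using h0) z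
    simpa using congrFun (congrFun this ()) ()
  have hcoef : ∀ a b : ℂ, fourierCoeffUnit 0 (fun z => a * thetaProd z τ + b * jacobiTheta₂ z τ)
      = a * fourierCoeffUnit 0 (fun z => thetaProd z τ) + b := fun a b => by
    have := hdθ.continuous
    have := hdP.continuous
    rw [fourierCoeffUnit_add (by fun_prop) (by fun_prop), fourierCoeffUnit_const_mul,
      fourierCoeffUnit_const_mul, fourierCoeffUnit_zero_jacobiTheta₂ hτ, mul_one]
  have := hprop 1 (-fourierCoeffUnit 0 fun z => thetaProd z τ) (by rw [hcoef]; ring) z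
  simpa [h] using this

/-- If `B A = ρ A B` with `A ≠ 0`, then `ρ` is a ratio of eigenvalues of `B`. -/
lemma exists_spectrum_of_mul_eq_smul_mul {n : ℕ} {A B : Matrix (Fin n) (Fin n) ℂ} {ρ : ℂ}
    (hρ : ρ ≠ 0) (hA : A ≠ 0) (h : B * A = ρ • (A * B)) :
    ∃ m ∈ spectrum ℂ B, ρ * m ∈ spectrum ℂ B := by
  have hcomm : SemiconjBy A (ρ • B) B := by
    show A * (ρ • B) = B * A
    rw [h, Matrix.mul_smul]
  have hpoly : ∀ p : Polynomial ℂ, A * Polynomial.aeval (ρ • B) p = Polynomial.aeval B p * A := by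
    intro p
    induction p using Polynomial.induction_on' with
    | add p q hp hq => rw [map_add, map_add, mul_add, add_mul, hp, hq]
    | monomial k a =>
      rw [Polynomial.aeval_monomial, Polynomial.aeval_monomial, ← mul_assoc,
        ← Algebra.commutes a A, mul_assoc, (hcomm.pow_right k).eq, mul_assoc]
  have hzero := hpoly B.charpoly
  rw [Matrix.aeval_self_charpoly, zero_mul] at hzero
  have hnot : ¬ IsUnit (Polynomial.aeval (ρ • B) B.charpoly) := fun hu =>
    hA (hu.mul_left_eq_zero.1 hzero)
  have : Nonempty (Fin n) := by
    by_contra hne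
    rw [not_nonempty_iff] at hne
    exact hA (Subsingleton.elim _ _)
  have h0 : (0 : ℂ) ∈ spectrum ℂ (Polynomial.aeval (ρ • B) B.charpoly) :=
    (spectrum.zero_mem_iff ℂ).2 hnot
  rw [spectrum.map_polynomial_aeval_of_nonempty _ _
    (spectrum.nonempty_of_isAlgClosed_of_finiteDimensional ℂ _)] at h0
  obtain ⟨x, hx, hx0⟩ := h0
  obtain ⟨m, hm, rfl⟩ := (spectrum.unit_smul_eq_smul B (Units.mk0 ρ hρ)).le hx
  exact ⟨m, hm, Matrix.mem_spectrum_iff_isRoot_charpoly.2 hx0⟩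

section NormedRing

variable {R : Type*} [NormedRing R]

lemma norm_units_pow_le (u : Rˣ) (n : ℕ) : ‖((u ^ n : Rˣ) : R)‖ ≤ ‖(1 : R)‖ * ‖(u : R)‖ ^ n := by
  induction n with
  | zero => simp
  | succ n ih =>
    rw [pow_succ, Units.val_mul, pow_succ, ← mul_assoc]
    exact (norm_mul_le _ _).trans (by gcongr)

lemma norm_units_zpow_le (u : Rˣ) (k : ℤ) :
    ‖((u ^ k : Rˣ) : R)‖ ≤ ‖(1 : R)‖ * (1 + ‖(u : R)‖ + ‖((u⁻¹ : Rˣ) : R)‖) ^ k.natAbs := by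
  have h1 := norm_nonneg (u : R)
  have h2 := norm_nonneg ((u⁻¹ : Rˣ) : R)
  obtain ⟨n, rfl | rfl⟩ := k.eq_nat_or_neg
  · rw [zpow_natCast, Int.natAbs_natCast]
    refine (norm_units_pow_le u n).trans ?_
    gcongr
    linarith
  · rw [_root_.zpow_neg, ← _root_.inv_zpow, zpow_natCast, Int.natAbs_neg, Int.natAbs_natCast]
    refine (norm_units_pow_le u⁻¹ n).trans ?_
    gcongr
    linarith

lemma exists_norm_zpow_conj_le (u : Rˣ) (A : R) :
    ∃ c r : ℝ, ∀ k : ℤ, ‖((u ^ (-k) : Rˣ) : R) * A * ((u ^ k : Rˣ) : R)‖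
      ≤ c * Real.exp (2 * Real.pi * r * |k|) := by
  set M := 1 + ‖(u : R)‖ + ‖((u⁻¹ : Rˣ) : R)‖ with hM
  have hM0 : 0 < M := by positivity
  refine ⟨‖(1 : R)‖ * ‖A‖ * ‖(1 : R)‖, Real.log M / Real.pi, fun k => ?_⟩
  have hexp : Real.exp (2 * Real.pi * (Real.log M / Real.pi) * |k|)
      = M ^ k.natAbs * M ^ k.natAbs := by
    rw [← pow_add, ← Real.exp_log (pow_pos hM0 _), Real.log_pow]
    congr 1
    rw [← Nat.cast_natAbs]
    push_cast
    field_simp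
    ring
  rw [hexp]
  have h1 := norm_units_zpow_le u (-k)
  rw [Int.natAbs_neg] at h1
  calc _ ≤ ‖((u ^ (-k) : Rˣ) : R)‖ * ‖A‖ * ‖((u ^ k : Rˣ) : R)‖ :=
        (norm_mul_le _ _).trans (by gcongr; exact norm_mul_le _ _)
    _ ≤ (‖(1 : R)‖ * M ^ k.natAbs) * ‖A‖ * (‖(1 : R)‖ * M ^ k.natAbs) := by
        gcongr
        exact norm_units_zpow_le u k
    _ = _ := by ring

end NormedRing

section BanachAlgebra

variable {R : Type*} [NormedRing R] [NormedAlgebra ℂ R]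

/-- The theta series `∑ exp(2πikz + πik²τ) u⁻ᵏ A uᵏ`. -/
def conjTheta (τ : ℂ) (u : Rˣ) (A : R) (z : ℂ) : R :=
  ∑' k : ℤ, jacobiTheta₂_term k z τ • (((u ^ (-k) : Rˣ) : R) * A * ((u ^ k : Rˣ) : R))

lemma exists_summable_bound_conjTheta {τ : ℂ} (hτ : 0 < τ.im) (u : Rˣ) (A : R) (S : ℝ) :
    ∃ b : ℤ → ℝ, Summable b ∧ ∀ (k : ℤ) (z : ℂ), |z.im| ≤ S →
      ‖jacobiTheta₂_term k z τ • (((u ^ (-k) : Rˣ) : R) * A * ((u ^ k : Rˣ) : R))‖ ≤ b k := by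
  obtain ⟨c, r, h⟩ := exists_norm_zpow_conj_le u A
  refine ⟨_, (summable_pow_mul_jacobiTheta₂_term_bound (S + r) hτ 0).mul_left c,
    fun k z hz => ?_⟩
  calc _ ≤ Real.exp (-Real.pi * (τ.im * k ^ 2 - 2 * S * |k|)) *
        (c * Real.exp (2 * Real.pi * r * |k|)) := by
        rw [norm_smul]
        gcongr
        · exact norm_jacobiTheta₂_term_le hτ hz le_rfl k
        · exact h k
    _ = _ := by
        rw [pow_zero, one_mul, mul_left_comm, ← Real.exp_add]
        congr 2
        push_cast
        ring

lemma conjTheta_add_one (τ : ℂ) (u : Rˣ) (A : R) (z : ℂ) :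
    conjTheta τ u A (z + 1) = conjTheta τ u A z := by
  unfold conjTheta
  congr 1
  ext k
  congr 1
  unfold jacobiTheta₂_term
  rw [Complex.exp_eq_exp_iff_exists_int]
  exact ⟨k, by ring⟩

lemma conjTheta_smul (τ : ℂ) (u : Rˣ) (a : ℂ) (A : R) (z : ℂ) :
    conjTheta τ u (a • A) z = a • conjTheta τ u A z := by
  unfold conjTheta
  rw [← tsum_const_smul'']
  simp only [mul_smul_comm, smul_mul_assoc, smul_comm a]

lemma zpow_conj_eq_smul {u : Rˣ} {A : R} {σ : ℂ} (hσ : σ ≠ 0)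
    (h : ((u⁻¹ : Rˣ) : R) * A * u = σ • A) (k : ℤ) :
    ((u ^ (-k) : Rˣ) : R) * A * ((u ^ k : Rˣ) : R) = σ ^ k • A := by
  let s : Rˣ := Units.map (algebraMap ℂ R).toMonoidHom (Units.mk0 σ hσ)
  have hsu : Commute s u := Units.ext (Algebra.commutes σ (u : R))
  have hs : SemiconjBy A (u : R) ((s * u : Rˣ) : R) := by
    show A * u = (algebraMap ℂ R σ * (u : R)) * A
    rw [← Algebra.smul_def, smul_mul_assoc, ← mul_smul_comm, ← h]
    simp [mul_assoc]
  have hsk : ((s ^ k : Rˣ) : R) = algebraMap ℂ R (σ ^ k) := by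
    rw [← map_zpow, Units.coe_map, Units.val_zpow_eq_zpow_val]
    rfl
  rw [mul_assoc, (hs.units_zpow_right k).eq, hsu.mul_zpow, (hsu.zpow_zpow k k).eq, ← mul_assoc,
    ← Units.val_mul, ← mul_assoc, ← _root_.zpow_add, neg_add_cancel, zpow_zero, one_mul, hsk,
    Algebra.smul_def]

/-- On an eigenvector of conjugation by `u`, the theta series is a scalar theta function. -/
lemma conjTheta_eq_smul {τ t : ℂ} {u : Rˣ} {A : R}
    (h : ((u⁻¹ : Rˣ) : R) * A * u = Complex.exp (2 * Real.pi * I * t) • A) (hτ : 0 < τ.im) (z : ℂ) :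
    conjTheta τ u A z = jacobiTheta₂ (z + t) τ • A := by
  unfold conjTheta jacobiTheta₂
  rw [← ((summable_jacobiTheta₂_term_iff (z + t) τ).2 hτ).tsum_smul_const]
  refine tsum_congr fun k => ?_
  rw [zpow_conj_eq_smul (Complex.exp_ne_zero _) h, smul_smul, ← Complex.exp_int_mul]
  congr 1
  unfold jacobiTheta₂_term
  rw [← Complex.exp_add]
  congr 1
  ring

variable [CompleteSpace R]

lemma summable_conjTheta {τ : ℂ} (hτ : 0 < τ.im) (u : Rˣ) (A : R) (z : ℂ) :
    Summable fun k : ℤ =>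
      jacobiTheta₂_term k z τ • (((u ^ (-k) : Rˣ) : R) * A * ((u ^ k : Rˣ) : R)) := by
  obtain ⟨b, hb, h⟩ := exists_summable_bound_conjTheta hτ u A |z.im|
  exact hb.of_norm_bounded fun k => h k z le_rfl

lemma differentiable_conjTheta {τ : ℂ} (hτ : 0 < τ.im) (u : Rˣ) (A : R) :
    Differentiable ℂ (conjTheta τ u A) := by
  intro z
  obtain ⟨b, hb, h⟩ := exists_summable_bound_conjTheta hτ u A (|z.im| + 1)
  have ho : IsOpen {w : ℂ | |w.im| < |z.im| + 1} := isOpen_lt (by fun_prop) (by fun_prop)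
  refine (Complex.differentiableOn_tsum_of_summable_norm hb (fun k => ?_) ho
    fun k w hw => h k w (le_of_lt hw)).differentiableAt (ho.mem_nhds (by simp))
  unfold jacobiTheta₂_term
  fun_prop

lemma conjTheta_add_tau_mul {τ : ℂ} (hτ : 0 < τ.im) (u : Rˣ) (A : R) (z : ℂ) :
    conjTheta τ u A (z + τ) * u
      = Complex.exp (-Real.pi * I * (τ + 2 * z)) • (u * conjTheta τ u A z) := by
  unfold conjTheta
  rw [← (summable_conjTheta hτ u A (z + τ)).tsum_mul_right,
    ← (summable_conjTheta hτ u A z).tsum_mul_left, ← tsum_const_smul'',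
    ← (Equiv.addRight (1 : ℤ)).tsum_eq (fun k : ℤ => Complex.exp (-Real.pi * I * (τ + 2 * z)) •
      ((u : R) * jacobiTheta₂_term k z τ • (((u ^ (-k) : Rˣ) : R) * A * ((u ^ k : Rˣ) : R))))]
  refine tsum_congr fun k => ?_
  simp only [Equiv.coe_addRight]
  rw [mul_smul_comm, smul_smul, smul_mul_assoc]
  congr 1
  · unfold jacobiTheta₂_term
    rw [← Complex.exp_add]
    congr 1
    push_cast
    ring
  · simp only [mul_assoc, ← Units.val_mul]
    rw [← mul_assoc (u : R), ← Units.val_mul, ← _root_.zpow_add_one, ← _root_.zpow_one_add]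
    congr 3
    ring

lemma conjTheta_add {τ : ℂ} (hτ : 0 < τ.im) (u : Rˣ) (A A' : R) (z : ℂ) :
    conjTheta τ u (A + A') z = conjTheta τ u A z + conjTheta τ u A' z := by
  unfold conjTheta
  rw [← (summable_conjTheta hτ u A z).tsum_add (summable_conjTheta hτ u A' z)]
  simp only [mul_add, add_mul, smul_add]

lemma conjTheta_conj {τ : ℂ} (hτ : 0 < τ.im) (u : Rˣ) (A : R) (z : ℂ) :
    conjTheta τ u (((u⁻¹ : Rˣ) : R) * A * u) z = ((u⁻¹ : Rˣ) : R) * conjTheta τ u A z * u := by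
  unfold conjTheta
  rw [← (summable_conjTheta hτ u A z).tsum_mul_left,
    ← ((summable_conjTheta hτ u A z).mul_left _).tsum_mul_right]
  refine tsum_congr fun k => ?_
  rw [mul_smul_comm, smul_mul_assoc]
  congr 1
  have e1 : ((u ^ (-k) : Rˣ) : R) * ((u⁻¹ : Rˣ) : R) = ((u⁻¹ : Rˣ) : R) * ((u ^ (-k) : Rˣ) : R) := by
    rw [← Units.val_mul, ← Units.val_mul, ← _root_.zpow_neg_one, ← _root_.zpow_add, ← _root_.zpow_add, add_comm]
  have e2 : (u : R) * ((u ^ k : Rˣ) : R) = ((u ^ k : Rˣ) : R) * (u : R) := by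
    rw [← Units.val_mul, ← Units.val_mul, ← _root_.zpow_one_add, ← _root_.zpow_add_one, add_comm]
  simp only [mul_assoc, e2]
  rw [← mul_assoc, e1, mul_assoc]

/-- The coefficient-to-value map `A ↦ conjTheta τ u A z`. -/
def conjThetaLinear {τ : ℂ} (hτ : 0 < τ.im) (u : Rˣ) (z : ℂ) : R →ₗ[ℂ] R where
  toFun A := conjTheta τ u A z
  map_add' A A' := conjTheta_add hτ u A A' z
  map_smul' a A := conjTheta_smul τ u a A z

lemma conjThetaLinear_surjective [FiniteDimensional ℂ R] {τ : ℂ} (hτ : 0 < τ.im) (u : Rˣ) (z : ℂ)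
    (h : ∀ (t : ℂ) (A : R), A ≠ 0 → ((u⁻¹ : Rˣ) : R) * A * u = Complex.exp (2 * Real.pi * I * t) • A →
      ¬ ∃ m k : ℤ, z + t = 1 / 2 + τ / 2 + m + k * τ) :
    Function.Surjective (conjThetaLinear hτ u z) := by
  rw [← LinearMap.injective_iff_surjective, ← LinearMap.ker_eq_bot]
  by_contra hne
  let K := LinearMap.ker (conjThetaLinear hτ u z)
  have : Nontrivial K := Submodule.nontrivial_iff_ne_bot.2 hne
  let T : R →ₗ[ℂ] R := LinearMap.mulRight ℂ (u : R) ∘ₗ LinearMap.mulLeft ℂ ((u⁻¹ : Rˣ) : R)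
  have hT : ∀ A ∈ K, T A ∈ K := fun A hA => by
    have hA' : conjTheta τ u A z = 0 := hA
    show conjTheta τ u (((u⁻¹ : Rˣ) : R) * A * u) z = 0
    rw [conjTheta_conj hτ, hA', mul_zero, zero_mul]
  obtain ⟨σ, hσ⟩ := Module.End.exists_eigenvalue (T.restrict hT)
  obtain ⟨A, hA⟩ := hσ.exists_hasEigenvector
  have hA0 : (A : R) ≠ 0 := fun h0 => hA.2 (Subtype.ext h0)
  have hAσ : ((u⁻¹ : Rˣ) : R) * A * u = σ • (A : R) := congrArg Subtype.val hA.apply_eq_smul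
  have hσ0 : σ ≠ 0 := by
    rintro rfl
    rw [zero_smul, Units.mul_left_eq_zero, Units.mul_right_eq_zero] at hAσ
    exact hA0 hAσ
  let t := Complex.log σ / (2 * Real.pi * I)
  have ht : Complex.exp (2 * Real.pi * I * t) = σ := by
    rw [mul_div_cancel₀ _ Complex.two_pi_I_ne_zero, Complex.exp_log hσ0]
  rw [← ht] at hAσ
  have hker : conjTheta τ u (A : R) z = 0 := A.2
  rw [conjTheta_eq_smul hAσ hτ, smul_eq_zero_iff_left hA0] at hker
  exact h t A hA0 hAσ (exists_of_jacobiTheta₂_eq_zero hτ hker)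

end BanachAlgebra

/-- The constant-coefficient map on `SolSpace`, taking the mean of each entry over a period. -/
def solMean (n : ℕ) (τ : ℂ) (B : Matrix (Fin n) (Fin n) ℂ) (c : ℂ → ℂ) :
    SolSpace n τ B c →ₗ[ℂ] Matrix (Fin n) (Fin n) ℂ where
  toFun Φ := .of fun i j => fourierCoeffUnit 0 fun z => Φ.1 z i j
  map_add' Φ Ψ := by
    ext i j
    exact fourierCoeffUnit_add (Φ.2.1 i j).continuous (Ψ.2.1 i j).continuous 0
  map_smul' a Φ := by
    ext i j
    exact fourierCoeffUnit_const_mul (fun z => Φ.1 z i j) 0 a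

lemma solMean_injective {n : ℕ} {τ : ℂ} {B : Matrix (Fin n) (Fin n) ℂ} (hB : IsUnit B)
    {c : ℂ → ℂ} {C : ℂ} (hC : C ≠ 0) (hc : ∀ z, c z = C * Complex.exp (-(2 * Real.pi * I * z))) :
    Function.Injective (solMean n τ B c) := by
  rw [injective_iff_map_eq_zero]
  rintro ⟨Φ, hd, hp, hq⟩ h0
  refine Subtype.ext (funext fun z => ?_)
  exact eq_zero_of_fourierCoeffUnit_zero_eq_zero hC hB hd hp (fun z => by rw [hq, hc])
    (fun i j => congrFun (congrFun h0 i) j) z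

lemma resEv_zero_surjective {n : ℕ} {τ : ℂ} (hτ : 0 < τ.im) {B : Matrix (Fin n) (Fin n) ℂ}
    (hB : IsUnit B) {v : ℂ} (hv : v ∉ SigmaSet n τ B) :
    Function.Surjective
      (resEv n τ B (fun z => -Complex.exp (-(2 * πc * I) * (z + v + τ))) 0) := by
  let : NormedRing (Matrix (Fin n) (Fin n) ℂ) := Matrix.linftyOpNormedRing
  let : NormedAlgebra ℂ (Matrix (Fin n) (Fin n) ℂ) := Matrix.linftyOpNormedAlgebra
  have : CompleteSpace (Matrix (Fin n) (Fin n) ℂ) := FiniteDimensional.complete ℂ _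
  obtain ⟨u, rfl⟩ := hB
  set s : ℂ := v + 1 / 2 + τ / 2 with hs
  have hsurj := conjThetaLinear_surjective hτ u s fun t A hA hAt => by
    rintro ⟨m, k, hmk⟩
    have hBA : (u : Matrix (Fin n) (Fin n) ℂ) * A
        = Complex.exp (2 * Real.pi * I * (-t)) • (A * (u : Matrix (Fin n) (Fin n) ℂ)) := by
      have e : A * (u : Matrix (Fin n) (Fin n) ℂ)
          = Complex.exp (2 * Real.pi * I * t) • ((u : Matrix (Fin n) (Fin n) ℂ) * A) := by
        rw [← mul_smul_comm, ← hAt, ← mul_assoc, ← mul_assoc, Units.mul_inv, one_mul]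
      rw [e, smul_smul, ← Complex.exp_add, ← mul_add, neg_add_cancel, mul_zero, Complex.exp_zero,
        one_smul]
    obtain ⟨x, hx, hx'⟩ := exists_spectrum_of_mul_eq_smul_mul (Complex.exp_ne_zero _) hA hBA
    have hx0 : x ≠ 0 := by
      rintro rfl
      exact (spectrum.zero_mem_iff ℂ).1 hx u.isUnit
    have hl : Complex.exp (2 * πc * I * (Complex.log x / (2 * πc * I))) = x := by
      rw [πc, mul_div_cancel₀ _ Complex.two_pi_I_ne_zero, Complex.exp_log hx0]
    refine hv ⟨Complex.log x / (2 * πc * I) - t, Complex.log x / (2 * πc * I), ?_, by rwa [hl],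
      m + k * τ, ⟨m, k, rfl⟩, ?_⟩
    · rw [sub_eq_neg_add, mul_add, Complex.exp_add, hl]
      exact hx'
    · rw [hs] at hmk
      linear_combination hmk
  intro M
  obtain ⟨A, hA⟩ := hsurj M
  refine ⟨⟨fun z => conjTheta τ u A (z + s), fun i j => ?_, fun z => ?_, fun z => ?_⟩, ?_⟩
  · have hd : Differentiable ℂ fun z => conjTheta τ u A (z + s) :=
      (differentiable_conjTheta hτ u A).comp (by fun_prop)
    exact (Matrix.entryLinearMap ℂ ℂ i j).toContinuousLinearMap.differentiable.comp hd
  · show conjTheta τ u A (z + 1 + s) = conjTheta τ u A (z + s)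
    rw [add_right_comm, conjTheta_add_one]
  · show conjTheta τ u A (z + τ + s) * (u : Matrix (Fin n) (Fin n) ℂ) = _
    rw [add_right_comm, conjTheta_add_tau_mul hτ]
    congr 1
    show _ = -Complex.exp _
    rw [← mul_neg_one (Complex.exp (-(2 * πc * I) * (z + v + τ))), ← Complex.exp_pi_mul_I, ← Complex.exp_add,
      Complex.exp_eq_exp_iff_exists_int]
    refine ⟨-1, ?_⟩
    rw [hs, πc]
    push_cast
    ring
  · show conjTheta τ u A (0 + s) = M
    rw [zero_add]
    exact hA

/-- If v ∉ Σ_B then the ℂ-linear map res₀ : Sol_{B,v} → Mat_{n×n}(ℂ), Φ ↦ Φ(0),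
is a linear isomorphism (i.e. it is bijective). -/
theorem res_zero_bijective (n : ℕ) (τ : ℂ) (hτ : 0 < τ.im)
    (B : Matrix (Fin n) (Fin n) ℂ) (hB : IsUnit B) (v : ℂ) (hv : v ∉ SigmaSet n τ B) :
    Function.Bijective
      (resEv n τ B (fun z => -Complex.exp (-(2 * πc * I) * (z + v + τ))) 0) := by
  have hsurj := resEv_zero_surjective hτ hB hv
  have hinj := solMean_injective (n := n) (τ := τ) hB
    (c := fun z => -Complex.exp (-(2 * πc * I) * (z + v + τ)))
    (C := -Complex.exp (-(2 * πc * I) * (v + τ))) (neg_ne_zero.2 (Complex.exp_ne_zero _))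
    fun z => by
      rw [neg_mul (Complex.exp _), ← Complex.exp_add, πc]
      congr 2
      ring
  have := FiniteDimensional.of_injective _ hinj
  have hrank := le_antisymm (LinearMap.finrank_le_finrank_of_injective hinj)
    (LinearMap.finrank_le_finrank_of_surjective hsurj)
  exact ⟨(LinearMap.injective_iff_surjective_of_finrank_eq_finrank hrank).2 hsurj, hsurj⟩
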